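/- Assume φ is intrinsically differentiable at every point of U and that the intrinsic gradient map a ↦ ∇^φφ(a) ∈ ℝ^{m−1} is continuous on U. Then for every j = 2,…,m, every C^1 integral curve γ : I → U of D^φ_j (i.e. γ'(t) = D^φ_j|_{γ(t)} for all t ∈ I) and every t_0 ∈ I, the function t ↦ φ(γ(t)) is differentiable at t_0 (one-sidedly if t_0 is an endpoint of I) with derivative (∇^φφ(γ(t_0)))_j. -/

import Mathlib

open MeasureTheory Filter Topology

namespace Step2

/-- The underlying space of the step-2 Carnot group `G = ℝ^m × ℝ^h`. -/
abbrev G (m h : ℕ) := (Fin m → ℝ) × (Fin h → ℝ)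

variable {m h : ℕ}

/-- Group product `(x,y)·(x',y') = (x+x', y+y' - (1/2)⟨Bx,x'⟩)`. -/
noncomputable def gmul (B : Fin h → Matrix (Fin m) (Fin m) ℝ) (p q : G m h) : G m h :=
  (p.1 + q.1, fun i => p.2 i + q.2 i - (1 / 2) * ∑ j, ∑ k, B i j k * p.1 k * q.1 j)

/-- Group inverse `g⁻¹ = -g`. -/
def ginv (p : G m h) : G m h := (-p.1, -p.2)

/-- Homogeneous norm `‖(x,y)‖ = Σ|x_j| + Σ|y_i|^(1/2)`. -/
noncomputable def hnorm (p : G m h) : ℝ :=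
  (∑ j, |p.1 j|) + ∑ i, Real.sqrt |p.2 i|

/-- Homogeneous (quasi-)distance `d(p,q) = ‖p⁻¹·q‖`. -/
noncomputable def gdist (B : Fin h → Matrix (Fin m) (Fin m) ℝ) (p q : G m h) : ℝ :=
  hnorm (gmul B (ginv p) q)

/-- Euclidean distance on `G`. -/
noncomputable def eDist (p q : G m h) : ℝ :=
  Real.sqrt ((∑ j, (p.1 j - q.1 j) ^ 2) + ∑ i, (p.2 i - q.2 i) ^ 2)

/-- The subgroup `W = {x_1 = 0}`. -/
def Wset (m h : ℕ) [NeZero m] : Set (G m h) := {p | p.1 0 = 0}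

/-- `U` is (relatively) open in `W`. -/
def RelOpen (m h : ℕ) [NeZero m] (U : Set (G m h)) : Prop :=
  ∃ O : Set (G m h), IsOpen O ∧ U = O ∩ Wset m h

/-- The graphing map `Φ(w) = (φ(w),0,…,0) ∈ L`. -/
noncomputable def Phi [NeZero m] (φ : G m h → ℝ) (w : G m h) : G m h :=
  ((fun j => if j = 0 then φ w else 0), 0)

/-- Horizontal coordinate vector `e_{x_j}`. -/
def eH (m h : ℕ) (j : Fin m) : G m h := ((fun j' => if j' = j then 1 else 0), 0)

/-- Vertical coordinate vector `e_{y_i}`. -/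
def eV (m h : ℕ) (i : Fin h) : G m h := (0, fun i' => if i' = i then 1 else 0)

/-- The projected vector field `D^φ_j` (for `j ≠ 0`, i.e. `j = 2,…,m` in 1-based indexing):
`D^φ_j|_w = ∂_{x_j} - Σ_i ( b^(i)_{j1} φ(w) + (1/2) Σ_{k≥2} x_k b^(i)_{jk} ) ∂_{y_i}`. -/
noncomputable def Dvec [NeZero m] (B : Fin h → Matrix (Fin m) (Fin m) ℝ)
    (φ : G m h → ℝ) (j : Fin m) (w : G m h) : G m h :=
  ((fun j' => if j' = j then 1 else 0),
   fun i => -(B i j 0 * φ w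
      + (1 / 2) * ∑ k ∈ Finset.univ.erase (0 : Fin m), w.1 k * B i j k))

/-- `D^φφ = ω` in the broad* sense on `U`. -/
def IsBroadStar [NeZero m] (B : Fin h → Matrix (Fin m) (Fin m) ℝ) (U : Set (G m h))
    (φ : G m h → ℝ) (ω : G m h → Fin m → ℝ) : Prop :=
  ∀ a₀ ∈ U, ∃ δ₁ δ₂ : ℝ, 0 < δ₂ ∧ δ₂ < δ₁ ∧
    ∀ j : Fin m, j ≠ 0 → ∃ E : G m h → ℝ → G m h,
      ∀ a, a ∈ U → eDist a a₀ ≤ δ₂ →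
        (∀ t ∈ Set.Icc (-δ₂) δ₂, E a t ∈ U ∧ eDist (E a t) a₀ ≤ δ₁) ∧
        E a 0 = a ∧
        (∀ t ∈ Set.Icc (-δ₂) δ₂,
          HasDerivWithinAt (E a) (Dvec B φ j (E a t)) (Set.Icc (-δ₂) δ₂) t) ∧
        (∀ t ∈ Set.Icc (-δ₂) δ₂, φ (E a t) - φ a = ∫ s in (0:ℝ)..t, ω (E a s) j)

/-- `φ` is vertically broad* Hölder on `U`. -/
def VertHolder (m h : ℕ) [NeZero m] (U : Set (G m h)) (φ : G m h → ℝ) : Prop :=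
  ∀ a₀ ∈ U, ∃ U' : Set (G m h), RelOpen m h U' ∧ a₀ ∈ U' ∧
    IsCompact (closure U') ∧ closure U' ⊆ U ∧
    ∀ i : Fin h, ∀ ε > (0:ℝ), ∃ ρ > (0:ℝ), ∀ p ∈ U', ∀ q ∈ U',
      p.1 = q.1 → (∀ i' : Fin h, i' ≠ i → p.2 i' = q.2 i') →
      0 < |p.2 i - q.2 i| → |p.2 i - q.2 i| ≤ ρ →
      |φ p - φ q| ≤ ε * Real.sqrt |p.2 i - q.2 i|

/-- The translated point `Φ(a)⁻¹·a⁻¹·b·Φ(a)`. -/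
noncomputable def shiftQ [NeZero m] (B : Fin h → Matrix (Fin m) (Fin m) ℝ)
    (φ : G m h → ℝ) (a b : G m h) : G m h :=
  gmul B (gmul B (gmul B (ginv (Phi φ a)) (ginv a)) b) (Phi φ a)

/-- `φ` is intrinsically differentiable at `a₀` with intrinsic gradient `grad`. -/
def IDAt [NeZero m] (B : Fin h → Matrix (Fin m) (Fin m) ℝ) (U : Set (G m h))
    (φ : G m h → ℝ) (a₀ : G m h) (grad : Fin m → ℝ) : Prop :=
  ∀ ε > (0:ℝ), ∃ r > (0:ℝ), ∀ b ∈ U, 0 < gdist B a₀ b → gdist B a₀ b < r →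
    |φ b - φ a₀ - ∑ j ∈ Finset.univ.erase (0 : Fin m), grad j * (b.1 j - a₀.1 j)|
      ≤ ε * hnorm (shiftQ B φ a₀ b)

/-- `φ` is uniformly intrinsically differentiable at `a₀` with intrinsic gradient `grad`. -/
def UIDAt [NeZero m] (B : Fin h → Matrix (Fin m) (Fin m) ℝ) (U : Set (G m h))
    (φ : G m h → ℝ) (a₀ : G m h) (grad : Fin m → ℝ) : Prop :=
  ∀ ε > (0:ℝ), ∃ r > (0:ℝ), ∀ a ∈ U, ∀ b ∈ U,
    gdist B a₀ a < r → gdist B a₀ b < r → a ≠ b →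
    |φ b - φ a - ∑ j ∈ Finset.univ.erase (0 : Fin m), grad j * (b.1 j - a.1 j)|
      ≤ ε * hnorm (shiftQ B φ a b)

/-- Projection onto `L` in the splitting `G = W·L`. -/
def piL (m h : ℕ) [NeZero m] (g : G m h) : G m h :=
  ((fun j => if j = 0 then g.1 0 else 0), 0)

/-- Projection onto `W` in the splitting `G = W·L`. -/
noncomputable def piW [NeZero m] (B : Fin h → Matrix (Fin m) (Fin m) ℝ) (g : G m h) : G m h :=
  ((fun j => if j = 0 then 0 else g.1 j),
   fun i => g.2 i + (1 / 2) * g.1 0 * ∑ k ∈ Finset.univ.erase (0 : Fin m), B i 0 k * g.1 k)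

/-- Coordinates `ℝ^(m-1) × ℝ^h → W ⊆ G`. -/
def emb (m h : ℕ) (u : (Fin (m - 1) → ℝ) × (Fin h → ℝ)) : G m h :=
  ((fun j => if hj : (j : ℕ) = 0 then 0
      else u.1 ⟨(j : ℕ) - 1, by have := j.isLt; omega⟩), u.2)

/-- The Lebesgue measure on `W`, as a measure on `G`. -/
noncomputable def muW (m h : ℕ) : Measure (G m h) :=
  Measure.map (emb m h) volume

end Step2

namespace Step2

section IntegralCurves

open Matrix

lemma sum_sum_eq_dotProduct (M : Matrix (Fin m) (Fin m) ℝ) (x z : Fin m → ℝ) :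
    ∑ j, ∑ k, M j k * x k * z j = (M *ᵥ x) ⬝ᵥ z := by
  simp only [dotProduct, mulVec, Finset.sum_mul]

lemma dotProduct_mulVec_swap {M : Matrix (Fin m) (Fin m) ℝ} (hM : M.transpose = -M)
    (x z : Fin m → ℝ) : (M *ᵥ x) ⬝ᵥ z = -((M *ᵥ z) ⬝ᵥ x) := by
  rw [dotProduct_comm, dotProduct_mulVec, ← mulVec_transpose, hM, neg_mulVec, neg_dotProduct]

lemma dotProduct_mulVec_self {M : Matrix (Fin m) (Fin m) ℝ} (hM : M.transpose = -M)
    (x : Fin m → ℝ) : (M *ᵥ x) ⬝ᵥ x = 0 := by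
  linarith [dotProduct_mulVec_swap hM x x]

lemma gmul_fst (B : Fin h → Matrix (Fin m) (Fin m) ℝ) (p q : G m h) :
    (gmul B p q).1 = p.1 + q.1 := rfl

lemma gmul_snd (B : Fin h → Matrix (Fin m) (Fin m) ℝ) (p q : G m h) (i : Fin h) :
    (gmul B p q).2 i = p.2 i + q.2 i - (1 / 2) * ((B i *ᵥ p.1) ⬝ᵥ q.1) := by
  rw [← sum_sum_eq_dotProduct]; rfl

lemma Phi_fst [NeZero m] (φ : G m h → ℝ) (w : G m h) :
    (Phi φ w).1 = φ w • Pi.single (0 : Fin m) (1 : ℝ) := by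
  ext k
  by_cases hk : k = 0 <;> simp [Phi, hk]

lemma continuous_gdist (B : Fin h → Matrix (Fin m) (Fin m) ℝ) (a : G m h) :
    Continuous (gdist B a) := by
  unfold gdist hnorm gmul
  fun_prop

lemma gdist_self {B : Fin h → Matrix (Fin m) (Fin m) ℝ} (hskew : ∀ i, (B i).transpose = -B i)
    (a : G m h) : gdist B a a = 0 := by
  simp [gdist, hnorm, gmul_fst, gmul_snd, ginv, mulVec_neg, neg_dotProduct,
    dotProduct_mulVec_self (hskew _)]

lemma gdist_pos_of_fst_ne (B : Fin h → Matrix (Fin m) (Fin m) ℝ) {a b : G m h} {j : Fin m}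
    (hj : a.1 j ≠ b.1 j) : 0 < gdist B a b := by
  unfold gdist hnorm
  refine add_pos_of_pos_of_nonneg ?_ (Finset.sum_nonneg fun i _ => Real.sqrt_nonneg _)
  refine Finset.sum_pos' (fun k _ => abs_nonneg _) ⟨j, Finset.mem_univ j, abs_pos.2 ?_⟩
  intro h0
  apply hj
  simp only [gmul_fst, ginv, Pi.add_apply, Pi.neg_apply] at h0
  linarith

lemma shiftQ_fst [NeZero m] (B : Fin h → Matrix (Fin m) (Fin m) ℝ) (φ : G m h → ℝ)
    (a b : G m h) : (shiftQ B φ a b).1 = b.1 - a.1 := by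
  simp only [shiftQ, gmul_fst, ginv]
  abel

lemma shiftQ_snd [NeZero m] {B : Fin h → Matrix (Fin m) (Fin m) ℝ}
    (hskew : ∀ i, (B i).transpose = -B i) (φ : G m h → ℝ) (a b : G m h) (j : Fin m) (s : ℝ)
    (hb : b.1 = a.1 + s • Pi.single j (1 : ℝ)) (i : Fin h) :
    (shiftQ B φ a b).2 i
      = b.2 i - a.2 i + s * (φ a * B i j 0 + (1 / 2) * ∑ k, B i j k * a.1 k) := by
  have h1 : (B i *ᵥ a.1) ⬝ᵥ Pi.single j (1 : ℝ) = ∑ k, B i j k * a.1 k := by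
    rw [dotProduct_single, mul_one]
    rfl
  have h2 : (B i *ᵥ Pi.single (0 : Fin m) (1 : ℝ)) ⬝ᵥ Pi.single j (1 : ℝ) = B i j 0 := by
    simp
  have h3 := dotProduct_mulVec_self (hskew i) a.1
  have h4 := dotProduct_mulVec_self (hskew i) (Pi.single (0 : Fin m) (1 : ℝ))
  have h5 := dotProduct_mulVec_swap (hskew i) a.1 (Pi.single (0 : Fin m) (1 : ℝ))
  have h6 := dotProduct_mulVec_swap (hskew i) (Pi.single j (1 : ℝ))
    (Pi.single (0 : Fin m) (1 : ℝ))
  rw [h2] at h6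
  have hP : (Phi φ a).2 i = 0 := rfl
  simp only [shiftQ, gmul_snd, gmul_fst, ginv, Phi_fst, hb, Pi.neg_apply, hP, mulVec_add,
    mulVec_neg, mulVec_smul, add_dotProduct, dotProduct_add, neg_dotProduct, dotProduct_neg,
    smul_dotProduct, dotProduct_smul, smul_eq_mul, h1, h2, h3, h4, h5, h6]
  ring

/-- The horizontal coordinates of an integral curve of `D^φ_j` move at unit speed along `e_j`. -/
lemma integralCurve_fst [NeZero m] {B : Fin h → Matrix (Fin m) (Fin m) ℝ} {φ : G m h → ℝ}
    {j : Fin m} {I : Set ℝ} (hI : Convex ℝ I) {γ : ℝ → G m h}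
    (hγ : ∀ t ∈ I, HasDerivWithinAt γ (Dvec B φ j (γ t)) I t) {s t : ℝ} (hs : s ∈ I)
    (ht : t ∈ I) : (γ t).1 = (γ s).1 + (t - s) • Pi.single j (1 : ℝ) := by
  have hd : ∀ r ∈ I, HasDerivWithinAt (fun r => (γ r).1 - r • Pi.single j (1 : ℝ)) 0 I r := by
    intro r hr
    have hfst : HasDerivWithinAt (fun r => (γ r).1) (Dvec B φ j (γ r)).1 I r := (hγ r hr).fst
    have h1 := hfst.sub ((hasDerivWithinAt_id r I).smul_const (Pi.single j (1 : ℝ)))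
    refine h1.congr_deriv ?_
    ext k
    by_cases hk : k = j <;> simp [Dvec, hk]
  have h0 := hI.norm_image_sub_le_of_norm_hasDerivWithin_le (C := 0) hd (by simp) hs ht
  rw [zero_mul, norm_le_zero_iff] at h0
  rw [sub_smul]
  linear_combination h0

/-- Along an integral curve of `D^φ_j`, the vertical part of the shifted point is controlled by
the oscillation of `φ` along the curve. -/
lemma abs_shiftQ_snd_le [NeZero m] {B : Fin h → Matrix (Fin m) (Fin m) ℝ}
    (hskew : ∀ i, (B i).transpose = -B i) {φ : G m h → ℝ} {j : Fin m} {I : Set ℝ}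
    (hI : Convex ℝ I) {γ : ℝ → G m h} (hW : ∀ t ∈ I, γ t ∈ Wset m h)
    (hγ : ∀ t ∈ I, HasDerivWithinAt γ (Dvec B φ j (γ t)) I t) {s t M : ℝ} (hs : s ∈ I)
    (ht : t ∈ I) (hM : ∀ r ∈ I, |φ (γ r) - φ (γ s)| ≤ M) (i : Fin h) :
    |(shiftQ B φ (γ s) (γ t)).2 i| ≤ |B i j 0| * M * |t - s| := by
  set c : ℝ := φ (γ s) * B i j 0 + (1 / 2) * ∑ k, B i j k * (γ s).1 k with hc
  have hjj : B i j j = 0 := by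
    have := congrFun (congrFun (hskew i) j) j
    simp only [transpose_apply, Matrix.neg_apply] at this
    linarith
  have hd : ∀ r ∈ I, HasDerivWithinAt (fun r => (γ r).2 i + r * c)
      (-(B i j 0 * (φ (γ r) - φ (γ s)))) I r := by
    intro r hr
    have hsnd : HasDerivWithinAt (fun r => (γ r).2) (Dvec B φ j (γ r)).2 I r := (hγ r hr).snd
    have h1 := (hasDerivWithinAt_pi.1 hsnd i).add ((hasDerivWithinAt_id r I).mul_const c)
    refine h1.congr_deriv ?_
    have h0 : (γ r).1 0 = 0 := hW r hr
    have hsum : ∑ k ∈ Finset.univ.erase (0 : Fin m), (γ r).1 k * B i j k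
        = ∑ k, B i j k * (γ s).1 k := by
      rw [Finset.sum_erase _ (by rw [h0, zero_mul])]
      refine Finset.sum_congr rfl fun k _ => ?_
      rw [integralCurve_fst hI hγ hs hr]
      by_cases hk : k = j
      · simp [hk, hjj]
      · simp [hk, mul_comm]
    simp only [Dvec, hsum, hc]
    ring
  have h2 := hI.norm_image_sub_le_of_norm_hasDerivWithin_le (C := |B i j 0| * M) hd
    (fun r hr => by
      rw [norm_neg, norm_mul]
      exact mul_le_mul_of_nonneg_left (hM r hr) (abs_nonneg _)) hs ht
  rw [shiftQ_snd hskew φ _ _ j (t - s) (integralCurve_fst hI hγ hs ht), ← hc]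
  rw [Real.norm_eq_abs, Real.norm_eq_abs] at h2
  convert h2 using 2
  ring

lemma hnorm_shiftQ_le [NeZero m] {B : Fin h → Matrix (Fin m) (Fin m) ℝ}
    (hskew : ∀ i, (B i).transpose = -B i) {φ : G m h → ℝ} {j : Fin m} {I : Set ℝ}
    (hI : Convex ℝ I) {γ : ℝ → G m h} (hW : ∀ t ∈ I, γ t ∈ Wset m h)
    (hγ : ∀ t ∈ I, HasDerivWithinAt γ (Dvec B φ j (γ t)) I t) {s t M : ℝ} (hs : s ∈ I)
    (ht : t ∈ I) (hM : ∀ r ∈ I, |φ (γ r) - φ (γ s)| ≤ M) :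
    hnorm (shiftQ B φ (γ s) (γ t))
      ≤ |t - s| + (∑ i, √|B i j 0|) * √(M * |t - s|) := by
  unfold hnorm
  refine add_le_add (le_of_eq ?_) ?_
  · rw [shiftQ_fst, integralCurve_fst hI hγ hs ht, add_sub_cancel_left]
    rw [Finset.sum_eq_single j]
    · simp
    · intro k _ hk
      simp [hk]
    · simp
  · rw [Finset.sum_mul]
    refine Finset.sum_le_sum fun i _ => ?_
    rw [← Real.sqrt_mul (abs_nonneg _), ← mul_assoc]
    exact Real.sqrt_le_sqrt (abs_shiftQ_snd_le hskew hI hW hγ hs ht hM i)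

/-- Along an integral curve of `D^φ_j`, the first-order increment of `φ` is controlled by the
oscillation of `φ` along the curve. -/
lemma IDAt.eventually_abs_sub_le [NeZero m] {B : Fin h → Matrix (Fin m) (Fin m) ℝ}
    (hskew : ∀ i, (B i).transpose = -B i) {U : Set (G m h)} (hUW : U ⊆ Wset m h)
    {φ : G m h → ℝ} {j : Fin m} (hj : j ≠ 0) {I : Set ℝ} (hI : Convex ℝ I) {γ : ℝ → G m h}
    (hU : ∀ t ∈ I, γ t ∈ U) (hγ : ∀ t ∈ I, HasDerivWithinAt γ (Dvec B φ j (γ t)) I t)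
    {s : ℝ} (hs : s ∈ I) {v : Fin m → ℝ} (hID : IDAt B U φ (γ s) v) {ε : ℝ} (hε : 0 < ε) :
    ∃ δ > 0, ∀ t ∈ I, |t - s| < δ → ∀ M : ℝ,
      (∀ r ∈ Set.uIcc s t, |φ (γ r) - φ (γ s)| ≤ M) →
      |φ (γ t) - φ (γ s) - v j * (t - s)|
        ≤ ε * (|t - s| + (∑ i, √|B i j 0|) * √(M * |t - s|)) := by
  obtain ⟨ρ, hρ, hb⟩ := hID ε hε
  have hcont : ContinuousWithinAt (fun t => gdist B (γ s) (γ t)) I s :=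
    (continuous_gdist B (γ s)).continuousAt.comp_continuousWithinAt (hγ s hs).continuousWithinAt
  obtain ⟨δ, hδ, hδρ⟩ := Metric.continuousWithinAt_iff.1 hcont ρ hρ
  refine ⟨δ, hδ, fun t ht htδ M hM => ?_⟩
  have hsub : Set.uIcc s t ⊆ I := hI.ordConnected.uIcc_subset hs ht
  have hγ' : ∀ r ∈ Set.uIcc s t, HasDerivWithinAt γ (Dvec B φ j (γ r)) (Set.uIcc s t) r :=
    fun r hr => (hγ r (hsub hr)).mono hsub
  have hnorm_le := hnorm_shiftQ_le hskew (convex_uIcc s t) (fun r hr => hUW (hU r (hsub hr))) hγ'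
    Set.left_mem_uIcc Set.right_mem_uIcc hM
  have hfst := integralCurve_fst hI hγ hs ht
  rcases eq_or_ne t s with rfl | hts
  · simp
  have hpos : 0 < gdist B (γ s) (γ t) := by
    refine gdist_pos_of_fst_ne (j := j) B ?_
    rw [hfst]
    simpa [sub_eq_zero] using hts
  have hlt : gdist B (γ s) (γ t) < ρ := by
    have := hδρ ht (by rwa [Real.dist_eq])
    rw [gdist_self hskew, Real.dist_eq, sub_zero] at this
    exact (le_abs_self _).trans_lt this
  have key := hb (γ t) (hU t ht) hpos hlt
  have hsum : ∑ k ∈ Finset.univ.erase (0 : Fin m), v k * ((γ t).1 k - (γ s).1 k)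
      = v j * (t - s) := by
    rw [hfst, Finset.sum_eq_single_of_mem j (by simp [hj])]
    · simp
    · intro k _ hk
      simp [hk]
  rw [hsum] at key
  exact key.trans (mul_le_mul_of_nonneg_left hnorm_le hε.le)

end IntegralCurves

/-- If `φ` is intrinsically differentiable at every point of `U` and the
intrinsic gradient map is continuous on `U`, then along every `C¹` integral curve `γ` of
`D^φ_j` the function `φ∘γ` is differentiable (one-sidedly at endpoints) with derivative
`(∇^φφ(γ(t₀)))_j`. -/
theorem statement6 (m h : ℕ) [NeZero m] (hm : 2 ≤ m) (hh : 1 ≤ h)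
    (B : Fin h → Matrix (Fin m) (Fin m) ℝ)
    (hskew : ∀ i, (B i).transpose = - B i) (hBli : LinearIndependent ℝ B)
    (U : Set (G m h)) (hUW : U ⊆ Wset m h) (hUopen : RelOpen m h U)
    (φ : G m h → ℝ) (hφ : ContinuousOn φ U)
    (grad : G m h → Fin m → ℝ)
    (hID : ∀ a ∈ U, IDAt B U φ a (grad a))
    (hcont : ∀ j : Fin m, j ≠ 0 → ContinuousOn (fun a => grad a j) U) :
    ∀ j : Fin m, j ≠ 0 → ∀ α β : ℝ, α ≤ β → ∀ γ : ℝ → G m h,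
      (∀ t ∈ Set.Icc α β, γ t ∈ U) →
      (∀ t ∈ Set.Icc α β, HasDerivWithinAt γ (Dvec B φ j (γ t)) (Set.Icc α β) t) →
      ∀ t₀ ∈ Set.Icc α β,
        HasDerivWithinAt (fun t => φ (γ t)) (grad (γ t₀) j) (Set.Icc α β) t₀ := by
  intro j hj α β _ γ hU hγ t₀ ht₀
  have hI : Convex ℝ (Set.Icc α β) := convex_Icc α β
  have hφγ : ContinuousOn (fun t => φ (γ t)) (Set.Icc α β) :=
    hφ.comp (fun t ht => (hγ t ht).continuousWithinAt) hU
  set C : ℝ := ∑ i, √|B i j 0| with hC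
  have hC0 : 0 ≤ C := Finset.sum_nonneg fun i _ => Real.sqrt_nonneg _
  set v : ℝ := grad (γ t₀) j with hv
  have key := fun ε hε => IDAt.eventually_abs_sub_le hskew hUW hj hI hU hγ ht₀
    (hID _ (hU t₀ ht₀)) (ε := ε) hε
  rw [← hC, ← hv] at key
  -- `φ ∘ γ` has linear growth at `t₀`.
  obtain ⟨δ₁, hδ₁, hgrow⟩ : ∃ δ > 0, ∀ t ∈ Set.Icc α β, |t - t₀| < δ →
      ∀ r ∈ Set.uIcc t₀ t, |φ (γ r) - φ (γ t₀)| ≤ (2 * |v| + 3) * |t - t₀| := by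
    have hε : 0 < 1 / (1 + C) := by positivity
    obtain ⟨δ, hδ, hk⟩ := key _ hε
    refine ⟨δ, hδ, fun t ht htδ => ?_⟩
    have hsub : Set.uIcc t₀ t ⊆ Set.Icc α β := hI.ordConnected.uIcc_subset ht₀ ht
    obtain ⟨σ, hσ, hmax⟩ := isCompact_uIcc.exists_isMaxOn Set.nonempty_uIcc
      ((hφγ.mono hsub).sub (continuousOn_const (c := φ (γ t₀)))).abs
    have hmax' : ∀ r ∈ Set.uIcc t₀ t, |φ (γ r) - φ (γ t₀)| ≤ |φ (γ σ) - φ (γ t₀)| :=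
      fun r hr => hmax hr
    have hσt : |σ - t₀| ≤ |t - t₀| := Set.abs_sub_left_of_mem_uIcc hσ
    have h1 := hk σ (hsub hσ) (hσt.trans_lt htδ) |φ (γ σ) - φ (γ t₀)|
      fun r hr => hmax' r (Set.uIcc_subset_uIcc Set.left_mem_uIcc hσ hr)
    set M : ℝ := |φ (γ σ) - φ (γ t₀)|
    have hM0 : 0 ≤ M := abs_nonneg _
    have hτ0 : 0 ≤ |σ - t₀| := abs_nonneg _
    have hsqrt : √(M * |σ - t₀|) ≤ (M + |σ - t₀|) / 2 :=
      Real.sqrt_le_iff.2 ⟨by positivity, by nlinarith [sq_nonneg (M - |σ - t₀|)]⟩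
    have h2 : 1 / (1 + C) * (|σ - t₀| + C * √(M * |σ - t₀|))
        ≤ |σ - t₀| + √(M * |σ - t₀|) := by
      rw [one_div, inv_mul_le_iff₀ (by positivity)]
      nlinarith [Real.sqrt_nonneg (M * |σ - t₀|), mul_nonneg hC0 hτ0]
    have h3 : M ≤ |φ (γ σ) - φ (γ t₀) - v * (σ - t₀)| + |v| * |σ - t₀| := by
      rw [← abs_mul]
      simpa using abs_add_le (φ (γ σ) - φ (γ t₀) - v * (σ - t₀)) (v * (σ - t₀))
    have h4 : M ≤ (2 * |v| + 3) * |σ - t₀| := by linarith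
    exact fun r hr => (hmax' r hr).trans (h4.trans (by gcongr))
  rw [hasDerivWithinAt_iff_isLittleO, Asymptotics.isLittleO_iff]
  intro c hc
  set K : ℝ := 2 * |v| + 3
  have hK : 0 ≤ K := by positivity
  have hD : 0 < 1 + C * √K := by positivity
  obtain ⟨δ₂, hδ₂, hk⟩ := key (c / (1 + C * √K)) (by positivity)
  filter_upwards [self_mem_nhdsWithin,
    mem_nhdsWithin_of_mem_nhds (Metric.ball_mem_nhds t₀ (lt_min hδ₁ hδ₂))] with t ht htδ
  rw [Metric.mem_ball, Real.dist_eq, lt_min_iff] at htδ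
  have h1 := hk t ht htδ.2 _ (hgrow t ht htδ.1)
  have h2 : √(K * |t - t₀| * |t - t₀|) = √K * |t - t₀| := by
    rw [mul_assoc, Real.sqrt_mul hK, Real.sqrt_mul_self (abs_nonneg _)]
  rw [h2] at h1
  rw [smul_eq_mul, mul_comm (t - t₀), Real.norm_eq_abs, Real.norm_eq_abs]
  refine h1.trans (le_of_eq ?_)
  field_simp

end Step2
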